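/- Let π = (s_1, …, s_V) be a detecting order, 1 ≤ k ≤ V−1, and let π' be obtained from π by swapping s_k and s_{k+1}. Set a = γ_{s_k}^{(D_{k−1})}, b = γ_{s_{k+1}}^{(D_{k−1})}, and Δ = Σ_{f ∈ ℱ_{s_k} ∩ ℱ_{s_{k+1}}} ( 1/((d_f^{(D_{k−1})} − 2) + λ) − 1/((d_f^{(D_{k−1})} − 1) + λ) ). Then Θ_π − Θ_{π'} = 2Δ(b − a); in particular Θ_π ≥ Θ_{π'} if and only if Δ(b − a) ≥ 0. -/

import Mathlib

open Finset

/-- The set of resources connected to user `v` in the factor graph `A`. -/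
def Fv {F V : ℕ} (A : Fin F → Fin V → Bool) (v : Fin V) : Finset (Fin F) :=
  Finset.univ.filter (fun f => A f v = true)

/-- The degree `d_f` of resource `f`: the number of users connected to it. -/
def deg {F V : ℕ} (A : Fin F → Fin V → Bool) (f : Fin F) : ℕ :=
  (Finset.univ.filter (fun v => A f v = true)).card

/-- The pruned degree `d_f^{(D)}` of resource `f` after the users in `D` are detected. -/
def prunedDeg {F V : ℕ} (A : Fin F → Fin V → Bool) (D : Finset (Fin V)) (f : Fin F) : ℕ :=
  (Finset.univ.filter (fun v => v ∉ D ∧ A f v = true)).card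

/-- The instantaneous SINR `γ_v^{(D)}` of an undetected user `v`. -/
noncomputable def gamma {F V : ℕ} (lam : ℝ) (A : Fin F → Fin V → Bool)
    (D : Finset (Fin V)) (v : Fin V) : ℝ :=
  ∑ f ∈ Fv A v, 1 / (((prunedDeg A D f : ℝ) - 1) + lam)

/-- The detected set `D_{k-1} = {s_1, …, s_{k-1}}` of users occupying positions before `k`
in the detecting order `π` (position `k` maps to user `π k`). -/
def Dset {V : ℕ} (π : Equiv.Perm (Fin V)) (k : Fin V) : Finset (Fin V) :=
  (Finset.univ.filter (fun j => j < k)).image π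

/-- The detecting SINR `γ_{s_k} = γ_{s_k}^{(D_{k-1})}` at position `k` of the order `π`. -/
noncomputable def detSINR {F V : ℕ} (lam : ℝ) (A : Fin F → Fin V → Bool)
    (π : Equiv.Perm (Fin V)) (k : Fin V) : ℝ :=
  gamma lam A (Dset π k) (π k)

/-- `Θ_π`, the sum of squared detecting SINRs. -/
noncomputable def Theta {F V : ℕ} (lam : ℝ) (A : Fin F → Fin V → Bool)
    (π : Equiv.Perm (Fin V)) : ℝ :=
  ∑ k : Fin V, (detSINR lam A π k) ^ 2

/-- `M_π`, the mean of the detecting SINR sequence. -/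
noncomputable def Mmean {F V : ℕ} (lam : ℝ) (A : Fin F → Fin V → Bool)
    (π : Equiv.Perm (Fin V)) : ℝ :=
  (1 / (V : ℝ)) * ∑ k : Fin V, detSINR lam A π k

/-- `V_π`, the variance of the detecting SINR sequence. -/
noncomputable def Vπ {F V : ℕ} (lam : ℝ) (A : Fin F → Fin V → Bool)
    (π : Equiv.Perm (Fin V)) : ℝ :=
  (1 / (V : ℝ)) * (∑ k : Fin V, (detSINR lam A π k) ^ 2) - (Mmean lam A π) ^ 2

theorem mem_Dset {V : ℕ} (π : Equiv.Perm (Fin V)) (j x : Fin V) :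
    x ∈ Dset π j ↔ π.symm x < j := by
  simp only [Dset, mem_image, mem_filter, mem_univ, true_and]
  constructor
  · rintro ⟨i, hi, rfl⟩
    simpa using hi
  · intro h
    exact ⟨π.symm x, h, by simp⟩

theorem Dset_eq_insert {V : ℕ} (π : Equiv.Perm (Fin V)) {i j : Fin V}
    (hij : (j : ℕ) = i + 1) : Dset π j = insert (π i) (Dset π i) := by
  ext x
  simp only [mem_insert, mem_Dset, ← Equiv.symm_apply_eq, Fin.lt_def, Fin.ext_iff]
  omega

theorem Dset_mul_swap {V : ℕ} (π : Equiv.Perm (Fin V)) {i j l : Fin V}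
    (h : i < l ↔ j < l) : Dset (π * Equiv.swap i j) l = Dset π l := by
  ext x
  obtain ⟨y, rfl⟩ := π.surjective x
  have hy : (π * Equiv.swap i j).symm (π y) = Equiv.swap i j y := by
    simp [Equiv.symm_apply_eq]
  rw [mem_Dset, mem_Dset, hy, Equiv.symm_apply_apply, Equiv.swap_apply_def]
  split_ifs with h₁ h₂
  · rw [h₁, h]
  · rw [h₂, h]
  · rfl

theorem prunedDeg_insert_of_adj {F V : ℕ} (A : Fin F → Fin V → Bool) {D : Finset (Fin V)}
    {u : Fin V} (hu : u ∉ D) {f : Fin F} (hf : A f u = true) :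
    prunedDeg A D f = prunedDeg A (insert u D) f + 1 := by
  unfold prunedDeg
  rw [← card_insert_of_notMem (a := u) (by simp)]
  congr 1
  ext v
  by_cases hv : v = u <;> simp_all

theorem prunedDeg_insert_of_not_adj {F V : ℕ} (A : Fin F → Fin V → Bool)
    (D : Finset (Fin V)) {u : Fin V} {f : Fin F} (hf : ¬ A f u = true) :
    prunedDeg A (insert u D) f = prunedDeg A D f := by
  unfold prunedDeg
  congr 1
  ext v
  by_cases hv : v = u <;> simp_all

/-- Detecting `u` raises the SINR of `v` by the increments at their shared resources. -/
theorem gamma_insert {F V : ℕ} (lam : ℝ) (A : Fin F → Fin V → Bool) {D : Finset (Fin V)}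
    {u : Fin V} (hu : u ∉ D) (v : Fin V) :
    gamma lam A (insert u D) v = gamma lam A D v +
      ∑ f ∈ Fv A u ∩ Fv A v, (1 / (((prunedDeg A D f : ℝ) - 2) + lam)
        - 1 / (((prunedDeg A D f : ℝ) - 1) + lam)) := by
  have hinter : Fv A u ∩ Fv A v = (Fv A v).filter (fun f => A f u = true) := by
    ext f
    simp [Fv, and_comm]
  rw [hinter, sum_filter, gamma, gamma, ← sum_add_distrib]
  refine sum_congr rfl fun f _ => ?_
  split_ifs with hf
  · rw [prunedDeg_insert_of_adj A hu hf]
    push_cast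
    ring_nf
  · rw [prunedDeg_insert_of_not_adj A D hf, add_zero]

/-- with `a = γ_{s_k}^{(D_{k−1})}`, `b = γ_{s_{k+1}}^{(D_{k−1})}` and the swap
increment `Δ`, one has `Θ_π − Θ_{π'} = 2Δ(b − a)`, so `Θ_π ≥ Θ_{π'} ↔ Δ(b − a) ≥ 0`. -/
theorem stmt_6 {F V : ℕ} (lam : ℝ) (hlam : 0 < lam) (A : Fin F → Fin V → Bool)
    (π : Equiv.Perm (Fin V)) (k : Fin V) (hk : (k : ℕ) + 1 < V) :
    let k' : Fin V := ⟨(k : ℕ) + 1, hk⟩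
    let π' : Equiv.Perm (Fin V) := π * Equiv.swap k k'
    let a : ℝ := gamma lam A (Dset π k) (π k)
    let b : ℝ := gamma lam A (Dset π k) (π k')
    let Δ : ℝ := ∑ f ∈ Fv A (π k) ∩ Fv A (π k'),
      (1 / (((prunedDeg A (Dset π k) f : ℝ) - 2) + lam)
        - 1 / (((prunedDeg A (Dset π k) f : ℝ) - 1) + lam))
    Theta lam A π - Theta lam A π' = 2 * Δ * (b - a) ∧
    (Theta lam A π ≥ Theta lam A π' ↔ Δ * (b - a) ≥ 0) := by
  intro k' π' a b Δ
  have hval : (k' : ℕ) = k + 1 := rfl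
  have hne : k ≠ k' := fun h => by
    have := congrArg Fin.val h
    omega
  have hDk : Dset π' k = Dset π k :=
    Dset_mul_swap π (by simp only [Fin.lt_def]; omega)
  have hπk : π' k = π k' := by simp [π']
  have hπk' : π' k' = π k := by simp [π']
  have h₁ : detSINR lam A π k' = b + Δ := by
    rw [detSINR, Dset_eq_insert π hval, gamma_insert lam A (by simp [mem_Dset])]
  have h₂ : detSINR lam A π' k = b := by rw [detSINR, hDk, hπk]
  have h₃ : detSINR lam A π' k' = a + Δ := by
    rw [detSINR, Dset_eq_insert π' hval, hDk, hπk, hπk',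
      gamma_insert lam A (by simp [mem_Dset, Fin.le_def, hval]), inter_comm]
  have hother : ∀ j ∈ (univ.erase k).erase k', detSINR lam A π' j = detSINR lam A π j := by
    intro j hj
    simp only [mem_erase, mem_univ, and_true] at hj
    have hD : Dset π' j = Dset π j := Dset_mul_swap π (by
      have := hj.1
      have := hj.2
      simp only [Fin.lt_def, ne_eq, Fin.ext_iff] at *
      omega)
    rw [detSINR, detSINR, hD]
    simp [π', Equiv.swap_apply_of_ne_of_ne hj.2 hj.1]
  have hsplit : ∀ σ : Equiv.Perm (Fin V), Theta lam A σ =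
      detSINR lam A σ k ^ 2 + (detSINR lam A σ k' ^ 2 +
        ∑ j ∈ (univ.erase k).erase k', detSINR lam A σ j ^ 2) := fun σ => by
    rw [add_sum_erase _ (fun j => detSINR lam A σ j ^ 2) (by simp [hne.symm]),
      add_sum_erase _ (fun j => detSINR lam A σ j ^ 2) (mem_univ k), Theta]
  have hmain : Theta lam A π - Theta lam A π' = 2 * Δ * (b - a) := by
    rw [hsplit π, hsplit π', sum_congr rfl fun j hj => congrArg (· ^ 2) (hother j hj), h₁, h₂, h₃,
      show detSINR lam A π k = a from rfl]
    ring
  refine ⟨hmain, ?_⟩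
  rw [ge_iff_le, ← sub_nonneg, hmain, mul_assoc]
  simp
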